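/- Let X be a bounded metric space with Borel σ-algebra and finite upper box dimension udim_B(X). Then for every Borel probability measure ν on X, the upper entropy dimension satisfies udim_E(ν) ≤ udim_B(X). -/

import Mathlib

open MeasureTheory ENNReal

/-- The Shannon function `sh(x) = -x·log₂ x` (with `sh 0 = 0`). -/
noncomputable def sh (x : ℝ) : ℝ := -(x * Real.logb 2 x)

/-- `P` is a `μ`-partition of `X`: a countable family of pairwise disjoint
measurable sets covering `X` up to a `μ`-null set. -/
def IsMuPartition {X : Type*} [MeasurableSpace X] (μ : Measure X) (P : Set (Set X)) : Prop :=
  P.Countable ∧ (∀ s ∈ P, MeasurableSet s) ∧ P.Pairwise Disjoint ∧ μ (⋃₀ P)ᶜ = 0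

/-- The `μ`-entropy `h(μ;P) = Σ_{P∈P} sh(μ(P))` of a family of sets. -/
noncomputable def partEntropy {X : Type*} [MeasurableSpace X] (μ : Measure X)
    (P : Set (Set X)) : ℝ≥0∞ :=
  ∑' s : P, ENNReal.ofReal (sh (μ s).toReal)

/-- `P ≺ Q` : every element of `P` is contained in some element of `Q`. -/
def Finer {X : Type*} (P Q : Set (Set X)) : Prop := ∀ p ∈ P, ∃ q ∈ Q, p ⊆ q

/-- The (classical) `μ`-entropy of a family `Q`:
`H(μ;Q) = inf { h(μ;P) : P a μ-partition, P ≺ Q }`, with `inf ∅ = ∞`. -/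
noncomputable def entropyH {X : Type*} [MeasurableSpace X] (μ : Measure X)
    (Q : Set (Set X)) : ℝ≥0∞ :=
  ⨅ (P : Set (Set X)) (_ : IsMuPartition μ P) (_ : Finer P Q), partEntropy μ P

/-- `m ∈ V(μ;Q)` : a weighting of `Q`, i.e. `m : Q → Measure X` with
`m_Q(X \ Q) = 0` for all `Q ∈ Q` and `Σ_{Q∈Q} m_Q = μ`. -/
def IsWeighting {X : Type*} [MeasurableSpace X] (μ : Measure X) (Q : Set (Set X))
    (m : Q → Measure X) : Prop :=
  (∀ q : Q, m q ((q : Set X))ᶜ = 0) ∧ Measure.sum m = μ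

/-- The weighted `μ`-entropy of `m ∈ V(μ;Q)` : `hv(μ;m) = Σ_{Q∈Q} sh(m_Q(X))`. -/
noncomputable def wEntropy {X : Type*} [MeasurableSpace X] (Q : Set (Set X))
    (m : Q → Measure X) : ℝ≥0∞ :=
  ∑' q : Q, ENNReal.ofReal (sh ((m q) Set.univ).toReal)

/-- The weighted `μ`-entropy of `Q` : `Hv(μ;Q) = inf { hv(μ;m) : m ∈ V(μ;Q) }`,
with `inf ∅ = ∞`. -/
noncomputable def entropyHv {X : Type*} [MeasurableSpace X] (μ : Measure X)
    (Q : Set (Set X)) : ℝ≥0∞ :=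
  ⨅ (m : Q → Measure X) (_ : IsWeighting μ Q m), wEntropy Q m

/-- The family of all closed balls of radius `δ`. -/
def ballFam (X : Type*) [PseudoMetricSpace X] (δ : ℝ) : Set (Set X) :=
  Set.range (fun x : X => Metric.closedBall x δ)

/-- The lower entropy dimension `liminf_{δ→0⁺} H(μ;B_δ)/(-log₂ δ)`. -/
noncomputable def ldimE {X : Type*} [PseudoMetricSpace X] [MeasurableSpace X]
    (μ : Measure X) : ℝ≥0∞ :=
  Filter.liminf (fun δ : ℝ => entropyH μ (ballFam X δ) / ENNReal.ofReal (-Real.logb 2 δ))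
    (nhdsWithin 0 (Set.Ioi 0))

/-- The upper entropy dimension `limsup_{δ→0⁺} H(μ;B_δ)/(-log₂ δ)`. -/
noncomputable def udimE {X : Type*} [PseudoMetricSpace X] [MeasurableSpace X]
    (μ : Measure X) : ℝ≥0∞ :=
  Filter.limsup (fun δ : ℝ => entropyH μ (ballFam X δ) / ENNReal.ofReal (-Real.logb 2 δ))
    (nhdsWithin 0 (Set.Ioi 0))

/-- `N_δ(S)` : the smallest number of closed balls of radius `δ` needed to cover `S`. -/
noncomputable def coverNum {X : Type*} [PseudoMetricSpace X] (S : Set X) (δ : ℝ) : ℝ≥0∞ :=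
  ⨅ (t : Finset X) (_ : S ⊆ ⋃ x ∈ t, Metric.closedBall x δ), (t.card : ℝ≥0∞)

/-- The natural logarithm on `ℝ≥0∞` (with `log ∞ = ∞`), truncated to `ℝ≥0∞`. -/
noncomputable def logENN (x : ℝ≥0∞) : ℝ≥0∞ :=
  if x = ⊤ then ⊤ else ENNReal.ofReal (Real.log x.toReal)

/-- The upper box dimension `limsup_{δ→0⁺} log N_δ(S)/(-log δ)`. -/
noncomputable def ubdimB {X : Type*} [PseudoMetricSpace X] (S : Set X) : ℝ≥0∞ :=
  Filter.limsup (fun δ : ℝ => logENN (coverNum S δ) / ENNReal.ofReal (-Real.log δ))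
    (nhdsWithin 0 (Set.Ioi 0))

/-- The upper local dimension `D̄_μ(x) = limsup_{δ→0⁺} log μ(B(x,δ))/log δ`
(interpreted as `∞` when `μ(B(x,δ)) = 0`). -/
noncomputable def upLocalDim {X : Type*} [PseudoMetricSpace X] [MeasurableSpace X]
    (μ : Measure X) (x : X) : ℝ≥0∞ :=
  Filter.limsup
    (fun δ : ℝ => if μ (Metric.closedBall x δ) = 0 then ⊤ else
      ENNReal.ofReal (Real.log (μ (Metric.closedBall x δ)).toReal / Real.log δ))
    (nhdsWithin 0 (Set.Ioi 0))

lemma sh_nonneg {x : ℝ} (h0 : 0 ≤ x) (h1 : x ≤ 1) : 0 ≤ sh x := by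
  have := mul_nonpos_of_nonneg_of_nonpos h0 (Real.logb_nonpos one_lt_two h0 h1)
  unfold sh
  linarith

/-- The tangent line bound for the concave function `sh` at the point `1 / n`. -/
lemma sh_mul_log_two_le {x n : ℝ} (hx : 0 ≤ x) (hn : 0 < n) :
    sh x * Real.log 2 ≤ x * Real.log n + 1 / n - x := by
  have hsh : sh x * Real.log 2 = -(x * Real.log x) := by
    have : Real.log 2 ≠ 0 := (Real.log_pos one_lt_two).ne'
    unfold sh Real.logb
    field_simp
  rw [hsh]
  rcases hx.eq_or_lt with rfl | hx
  · simp [hn.le]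
  have h := mul_le_mul_of_nonneg_left
    (Real.log_le_sub_one_of_pos (show 0 < 1 / (n * x) by positivity)) hx.le
  rw [one_div, Real.log_inv, Real.log_mul hn.ne' hx.ne'] at h
  have hx' : x * ((n * x)⁻¹ - 1) = 1 / n - x := by field_simp
  linarith

/-- The Shannon entropy of a probability vector with at most `n` entries is at most `log₂ n`. -/
lemma sum_sh_le_logb {ι : Type*} (s : Finset ι) (p : ι → ℝ) (hp : ∀ i ∈ s, 0 ≤ p i)
    (hsum : ∑ i ∈ s, p i = 1) {n : ℕ} (hn : 0 < n) (hcard : s.card ≤ n) :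
    ∑ i ∈ s, sh (p i) ≤ Real.logb 2 n := by
  have hn' : (0 : ℝ) < n := by exact_mod_cast hn
  have hcard' : (s.card : ℝ) * (1 / n) ≤ 1 := by
    rw [mul_one_div, div_le_one hn']
    exact_mod_cast hcard
  rw [Real.logb, le_div_iff₀ (Real.log_pos one_lt_two), Finset.sum_mul]
  calc ∑ i ∈ s, sh (p i) * Real.log 2
      ≤ ∑ i ∈ s, (p i * Real.log n + 1 / n - p i) :=
        Finset.sum_le_sum fun i hi => sh_mul_log_two_le (hp i hi) hn'
    _ = Real.log n + s.card * (1 / n) - 1 := by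
        rw [Finset.sum_sub_distrib, Finset.sum_add_distrib, ← Finset.sum_mul, hsum]
        simp
    _ ≤ Real.log n := by linarith

lemma partEntropy_le_logb {X : Type*} [MeasurableSpace X] (ν : Measure X)
    [IsProbabilityMeasure ν] (P : Finset (Set X))
    (hP : IsMuPartition ν (P : Set (Set X))) {n : ℕ} (hn : 0 < n) (hcard : P.card ≤ n) :
    partEntropy ν (P : Set (Set X)) ≤ ENNReal.ofReal (Real.logb 2 n) := by
  obtain ⟨-, hmeas, hdisj, hnull⟩ := hP
  have hsum : ∑ s ∈ P, ν.real s = 1 := by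
    have hU : MeasurableSet (⋃₀ (P : Set (Set X))) :=
      MeasurableSet.sUnion P.countable_toSet hmeas
    have h1 : ν.real (⋃ s ∈ P, s) = 1 := by
      have : (⋃ s ∈ P, s) = ⋃₀ (P : Set (Set X)) := by simp [Set.sUnion_eq_biUnion]
      rw [this, Measure.real, (prob_compl_eq_zero_iff hU).1 hnull, ENNReal.toReal_one]
    rw [← h1, measureReal_biUnion_finset (fun s hs t ht hst => hdisj hs ht hst) hmeas]
  change ∑' s : (P : Set (Set X)), ENNReal.ofReal (sh (ν.real s)) ≤ _
  rw [Finset.tsum_subtype' P fun s => ENNReal.ofReal (sh (ν.real s)),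
    ← ENNReal.ofReal_sum_of_nonneg fun s _ => sh_nonneg measureReal_nonneg measureReal_le_one]
  exact ENNReal.ofReal_le_ofReal
    (sum_sh_le_logb P ν.real (fun _ _ => measureReal_nonneg) hsum hn hcard)

/-- A finite measurable cover can be disjointed without increasing its cardinality. -/
lemma entropyH_le_logb {X : Type*} [MeasurableSpace X] (ν : Measure X)
    [IsProbabilityMeasure ν] {Q : Set (Set X)} {n : ℕ} (f : Fin n → Set X)
    (hfQ : ∀ i, f i ∈ Q) (hmeas : ∀ i, MeasurableSet (f i)) (hcover : ⋃ i, f i = Set.univ) :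
    entropyH ν Q ≤ ENNReal.ofReal (Real.logb 2 n) := by
  classical
  have hn : 0 < n := by
    obtain ⟨x⟩ := nonempty_of_isProbabilityMeasure ν
    obtain ⟨i, -⟩ := Set.mem_iUnion.1 (hcover.symm ▸ Set.mem_univ x)
    exact i.pos
  let P : Finset (Set X) := Finset.univ.image (disjointed f)
  have hP : (P : Set (Set X)) = Set.range (disjointed f) := by simp [P]
  have hpart : IsMuPartition ν (P : Set (Set X)) := by
    refine ⟨P.countable_toSet, ?_, ?_, ?_⟩
    · rw [hP]
      rintro _ ⟨i, rfl⟩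
      exact disjointedRec (fun _ _ ht => ht.diff (hmeas _)) (hmeas i)
    · rw [hP]
      exact (disjoint_disjointed f).range_pairwise
    · rw [hP, Set.sUnion_range, iUnion_disjointed, hcover, Set.compl_univ, measure_empty]
  have hfiner : Finer (P : Set (Set X)) Q := by
    rw [hP]
    rintro _ ⟨i, rfl⟩
    exact ⟨f i, hfQ i, disjointed_subset f i⟩
  refine (iInf₂_le_of_le _ hpart (iInf_le _ hfiner)).trans (partEntropy_le_logb ν P hpart hn ?_)
  simpa using Finset.card_image_le (s := Finset.univ) (f := disjointed f)

lemma exists_card_eq_coverNum {X : Type*} [PseudoMetricSpace X] {S : Set X} {δ : ℝ}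
    (h : coverNum S δ ≠ ⊤) :
    ∃ t : Finset X, S ⊆ ⋃ x ∈ t, Metric.closedBall x δ ∧ (t.card : ℝ≥0∞) = coverNum S δ := by
  let T : Set (Finset X) := {t | S ⊆ ⋃ x ∈ t, Metric.closedBall x δ}
  have hT : T.Nonempty := by
    by_contra hT
    refine h (iInf₂_eq_top.2 fun t ht => (hT ⟨t, ht⟩).elim)
  obtain ⟨t, ht, hmin⟩ := exists_minimalFor_of_wellFoundedLT (· ∈ T) Finset.card hT
  refine ⟨t, ht, le_antisymm (le_iInf₂ fun u hu => ?_) (iInf₂_le t ht)⟩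
  rcases le_total t.card u.card with h' | h'
  · exact_mod_cast h'
  · exact_mod_cast hmin hu h'

lemma entropyH_ballFam_le {X : Type*} [PseudoMetricSpace X] [MeasurableSpace X] [BorelSpace X]
    (ν : Measure X) [IsProbabilityMeasure ν] (t : Finset X) {δ : ℝ}
    (ht : Set.univ ⊆ ⋃ x ∈ t, Metric.closedBall x δ) :
    entropyH ν (ballFam X δ) ≤ ENNReal.ofReal (Real.logb 2 t.card) := by
  refine entropyH_le_logb ν (fun i => Metric.closedBall (t.equivFin.symm i : X) δ)
    (fun i => ⟨_, rfl⟩) (fun i => Metric.isClosed_closedBall.measurableSet) ?_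
  refine Set.univ_subset_iff.1 fun x hx => ?_
  obtain ⟨y, hy, hxy⟩ := Set.mem_iUnion₂.1 (ht hx)
  exact Set.mem_iUnion.2 ⟨t.equivFin ⟨y, hy⟩, by simpa using hxy⟩

lemma entropyH_div_le_logENN_coverNum_div {X : Type*} [PseudoMetricSpace X] [MeasurableSpace X]
    [BorelSpace X] (ν : Measure X) [IsProbabilityMeasure ν] {δ : ℝ} (h0 : 0 < δ) (h1 : δ < 1) :
    entropyH ν (ballFam X δ) / ENNReal.ofReal (-Real.logb 2 δ) ≤
      logENN (coverNum (Set.univ : Set X) δ) / ENNReal.ofReal (-Real.log δ) := by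
  by_cases hN : coverNum (Set.univ : Set X) δ = ⊤
  · simp [logENN, hN, ENNReal.top_div_of_ne_top]
  obtain ⟨t, ht, hcard⟩ := exists_card_eq_coverNum hN
  have hlog : 0 < -Real.log δ := neg_pos.2 (Real.log_neg h0 h1)
  have hlogb : 0 < -Real.logb 2 δ := neg_pos.2 (Real.logb_neg one_lt_two h0 h1)
  refine (ENNReal.div_le_div_right (entropyH_ballFam_le ν t ht) _).trans_eq ?_
  rw [logENN, if_neg hN, ← hcard, ENNReal.toReal_natCast, ← ENNReal.ofReal_div_of_pos hlogb,
    ← ENNReal.ofReal_div_of_pos hlog, Real.logb, Real.logb, ← neg_div,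
    div_div_div_cancel_right₀ (Real.log_pos one_lt_two).ne']

/-- if `X` is a bounded metric space with finite upper box dimension, then
`udim_E(ν) ≤ udim_B(X)` for every Borel probability measure `ν` on `X`. -/
theorem udimE_le_ubdimB {X : Type*} [MetricSpace X] [MeasurableSpace X] [BorelSpace X]
    (hbdd : Bornology.IsBounded (Set.univ : Set X))
    (hbox : ubdimB (Set.univ : Set X) < ⊤)
    (ν : Measure X) [IsProbabilityMeasure ν] :
    udimE ν ≤ ubdimB (Set.univ : Set X) := by
  refine Filter.limsup_le_limsup ?_
  filter_upwards [Ioo_mem_nhdsGT zero_lt_one] with δ hδ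
  exact entropyH_div_le_logENN_coverNum_div ν hδ.1 hδ.2
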